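/- arXiv:nlin/0204070 — 5 statements merged into one kernel-verified Lean document; each statement's English description precedes it below -/
import Mathlib

section
/- Let a, b : ℕ → ℂ and let x : ℕ → ℂ with x_n ≠ 0 for all n satisfy x_{n+1} = -a_n - b_n/x_n - 1/(x_n·x_{n-1}) for all n ≥ 1. Define s_0 = 1 and s_{n+1} = x_n·s_n. Then s satisfies the linear recurrence s_{n+2} = -a_n·s_{n+1} - b_n·s_n - s_{n-1} for all n ≥ 1. -/
/-- If `x` never vanishes and satisfies `x_{n+1} = -a_n - b_n/x_n - 1/(x_n x_{n-1})`
for `n ≥ 1`, and `s` is defined by `s_0 = 1`, `s_{n+1} = x_n s_n`, then `s` satisfies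
the linear recurrence `s_{n+2} = -a_n s_{n+1} - b_n s_n - s_{n-1}` for `n ≥ 1`. -/
theorem stmt1 (a b x s : ℕ → ℂ)
    (hx : ∀ n, x n ≠ 0)
    (hrec : ∀ n, 1 ≤ n →
      x (n + 1) = -a n - b n / x n - 1 / (x n * x (n - 1)))
    (hs0 : s 0 = 1)
    (hs : ∀ n, s (n + 1) = x n * s n) :
    ∀ n, 1 ≤ n → s (n + 2) = -a n * s (n + 1) - b n * s n - s (n - 1) := by
  intro n hn
  obtain ⟨m, rfl⟩ := Nat.exists_eq_add_of_le' hn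
  have hm := hx m
  have hm1 := hx (m + 1)
  have h := hrec (m + 1) hn
  rw [Nat.add_sub_cancel] at h ⊢
  rw [hs (m + 1 + 1), hs (m + 1), hs m, h]
  field_simp
end

section
/- Let a, b : ℕ → ℂ and let x, y ∈ ℂ. Define sequences A, B, C : ℕ → ℂ, each satisfying the linear recurrence t_{n+2} = -a_n·t_{n+1} - b_n·t_n - t_{n-1} for n ≥ 1, with initial values A_0 = 1, A_1 = 0, A_2 = 0; B_0 = 0, B_1 = 1, B_2 = 0; C_0 = 0, C_1 = 0, C_2 = 1. Assume A_n + B_n·x + C_n·x·y ≠ 0 for all n. Then the sequence x_n := (A_{n+1} + B_{n+1}·x + C_{n+1}·x·y)/(A_n + B_n·x + C_n·x·y) satisfies x_0 = x, x_1 = y, and x_{n+1} = -a_n - b_n/x_n - 1/(x_n·x_{n-1}) for all n ≥ 1. In particular, every iterate of the mapping is a ratio of polynomials of degree at most 1 in x and at most 1 in y, so the degree of the iterates is bounded (constant degree growth). -/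
/-- Linearisation of `x_{n+1} = -a_n - b_n/x_n - 1/(x_n x_{n-1})`: with `A, B, C`
solutions of the linear recurrence `t_{n+2} = -a_n t_{n+1} - b_n t_n - t_{n-1}` with the
indicated initial data, the sequence `x_n := (A_{n+1} + B_{n+1} x + C_{n+1} x y)/(A_n + B_n x + C_n x y)`
starts at `(x, y)` and satisfies the nonlinear recurrence; hence the iterates have
bounded (constant) degree, of degree at most 1 in each of `x` and `y`. -/
theorem stmt3 (a b : ℕ → ℂ) (x y : ℂ) (A B C : ℕ → ℂ)
    (hA : ∀ n, 1 ≤ n → A (n + 2) = -a n * A (n + 1) - b n * A n - A (n - 1))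
    (hB : ∀ n, 1 ≤ n → B (n + 2) = -a n * B (n + 1) - b n * B n - B (n - 1))
    (hC : ∀ n, 1 ≤ n → C (n + 2) = -a n * C (n + 1) - b n * C n - C (n - 1))
    (hA0 : A 0 = 1) (hA1 : A 1 = 0) (hA2 : A 2 = 0)
    (hB0 : B 0 = 0) (hB1 : B 1 = 1) (hB2 : B 2 = 0)
    (hC0 : C 0 = 0) (hC1 : C 1 = 0) (hC2 : C 2 = 1)
    (hne : ∀ n, A n + B n * x + C n * x * y ≠ 0)
    (X : ℕ → ℂ)
    (hX : ∀ n, X n = (A (n + 1) + B (n + 1) * x + C (n + 1) * x * y)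
                      / (A n + B n * x + C n * x * y)) :
    X 0 = x ∧ X 1 = y ∧
    ∀ n, 1 ≤ n → X (n + 1) = -a n - b n / X n - 1 / (X n * X (n - 1)) := by
  have hx : x ≠ 0 := by simpa [hA1, hB1, hC1] using hne 1
  refine ⟨by simp [hX, hA0, hB0, hC0, hA1, hB1, hC1], ?_, ?_⟩
  · simp [hX, hA1, hB1, hC1, hA2, hB2, hC2, hx]
  · intro n hn
    set T : ℕ → ℂ := fun n => A n + B n * x + C n * x * y with hT
    have hT_ne : ∀ n, T n ≠ 0 := hne
    have hX_eq : ∀ n, X n = T (n + 1) / T n := hX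
    have hT_rec : T (n + 2) = -a n * T (n + 1) - b n * T n - T (n - 1) := by
      simp only [hT, hA n hn, hB n hn, hC n hn]
      ring
    have h₀ := hT_ne (n - 1)
    have h₁ := hT_ne n
    have h₂ := hT_ne (n + 1)
    rw [hX_eq (n + 1), hX_eq n, hX_eq (n - 1), Nat.sub_add_cancel hn, hT_rec]
    clear_value T
    field_simp
end

section
/- Let a : ℕ → ℂ, and for k ≥ 1 set c_k := Σ_{j=1}^{k} (-1)^{k-j}·a_j. Let p, q ∈ ℂ with p ≠ 0, q ≠ 0 and (-1)^k·q + c_k·p ≠ 0 for all k ≥ 1. Define x₀ = p, x₁ = q, and x_{n+1} = (a_n - x_n/x_{n-1})·x_n for n ≥ 1. Then all x_n are nonzero and for every m ≥ 1, x_{m+1} = q·∏_{k=1}^{m} ((-1)^k·q + c_k·p) / p^m. In particular the m-th iterate is the ratio of a polynomial in (p,q) of degree m+1 by p^m, exhibiting linear growth of the degree of the iterates. -/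
/-- The alternating partial sums of `a` satisfy `c_{n+1} = a_{n+1} - c_n`. -/
theorem sum_Icc_neg_one_pow_sub_mul_succ {R : Type*} [CommRing R] (a : ℕ → R) (n : ℕ) :
    ∑ j ∈ Finset.Icc 1 (n + 1), (-1 : R) ^ (n + 1 - j) * a j =
      a (n + 1) - ∑ j ∈ Finset.Icc 1 n, (-1 : R) ^ (n - j) * a j := by
  have h : ∑ j ∈ Finset.Icc 1 n, (-1 : R) ^ (n + 1 - j) * a j =
      -∑ j ∈ Finset.Icc 1 n, (-1 : R) ^ (n - j) * a j := by
    rw [← Finset.sum_neg_distrib]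
    refine Finset.sum_congr rfl fun j hj => ?_
    rw [Nat.sub_add_comm (Finset.mem_Icc.mp hj).2, pow_succ]
    ring
  rw [Finset.sum_Icc_succ_top (by omega), h]
  simp
  ring

/-- Linear degree growth for the Riccati mapping `x_{n+1} = (a_n - x_n/x_{n-1}) x_n`:
with initial data `x_0 = p`, `x_1 = q` and `c_k := Σ_{j=1}^k (-1)^{k-j} a_j`, all the
`x_n` are nonzero and `x_{m+1} = q ∏_{k=1}^m ((-1)^k q + c_k p) / p^m`, a ratio of a
polynomial in `(p,q)` of degree `m+1` by `p^m`. -/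
theorem stmt7 (a : ℕ → ℂ) (c : ℕ → ℂ)
    (hc : ∀ k, 1 ≤ k → c k = ∑ j ∈ Finset.Icc 1 k, (-1 : ℂ) ^ (k - j) * a j)
    (p q : ℂ) (hp : p ≠ 0) (hq : q ≠ 0)
    (hne : ∀ k, 1 ≤ k → (-1 : ℂ) ^ k * q + c k * p ≠ 0)
    (x : ℕ → ℂ) (hx0 : x 0 = p) (hx1 : x 1 = q)
    (hrec : ∀ n, 1 ≤ n → x (n + 1) = (a n - x n / x (n - 1)) * x n) :
    (∀ n, x n ≠ 0) ∧
    (∀ m, 1 ≤ m →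
      x (m + 1) = q * (∏ k ∈ Finset.Icc 1 m, ((-1 : ℂ) ^ k * q + c k * p)) / p ^ m) := by
  have hstep : ∀ n, x n ≠ 0 ∧ x (n + 1) ≠ 0 ∧
      x (n + 2) = ((-1 : ℂ) ^ (n + 1) * q + c (n + 1) * p) / p * x (n + 1) := by
    intro n
    induction n with
    | zero =>
      have hc1 : c 1 = a 1 := by simp [hc 1 le_rfl]
      refine ⟨hx0 ▸ hp, by simpa [hx1] using hq, ?_⟩
      rw [hrec 1 le_rfl]
      simp only [Nat.sub_self, zero_add, hx0, hx1, hc1]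
      field_simp
      ring
    | succ n ih =>
      obtain ⟨-, h1, h2⟩ := ih
      have hx2 : x (n + 2) ≠ 0 := by
        rw [h2]
        exact mul_ne_zero (div_ne_zero (hne _ (by omega)) hp) h1
      have hcs : c (n + 2) = a (n + 2) - c (n + 1) := by
        rw [hc _ (by omega), hc (n + 1) (by omega), sum_Icc_neg_one_pow_sub_mul_succ]
      have hratio : x (n + 2) / x (n + 1) =
          ((-1 : ℂ) ^ (n + 1) * q + c (n + 1) * p) / p := by
        rw [h2, mul_div_cancel_right₀ _ h1]
      refine ⟨h1, hx2, ?_⟩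
      rw [hrec (n + 2) (by omega), show n + 2 - 1 = n + 1 from rfl, hratio, hcs]
      congr 1
      field_simp
      ring
  refine ⟨fun n => (hstep n).1, fun m hm => ?_⟩
  induction m, hm using Nat.le_induction with
  | base =>
    rw [(hstep 0).2.2]
    simp [hx1]
    ring
  | succ m hm ih =>
    obtain ⟨k, rfl⟩ := Nat.exists_eq_add_of_le' hm
    rw [(hstep (k + 1)).2.2, ih,
      Finset.prod_Icc_succ_top (show 1 ≤ k + 1 + 1 by omega), pow_succ p (k + 1),
      div_mul_div_comm]
    congr 1 <;> ring
end

section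
/- Let g, h, k ∈ ℂ with h + k ≠ 0, let c ∈ ℂ, and let x, y ∈ ℂ with E := x·y + y² - (g+k)·x + (h-k)·y ≠ 0. Define x̄ = y, ȳ = -y·(x·y + y² - (g-h)·x + 2h·y)/E, and c̄ = ((g+h)/(h+k))·(c + g - h). If c·(x+y)² + y·(x² - h·y + x·y + g·(2x+y)) = 0, then c̄·(x̄+ȳ)² + ȳ·(x̄² - k·ȳ + x̄·ȳ + h·(2x̄+ȳ)) = 0. That is, the mapping sends the curve of the family at level n with parameter c into the curve of the family at level n+1 with parameter c̄. -/
/-- The mapping `x̄ = y`, `ȳ = -y(xy + y² - (g-h)x + 2hy)/E`, together with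
`c̄ = ((g+h)/(h+k))(c + g - h)`, sends the curve
`c(x+y)² + y(x² - h y + x y + g(2x+y)) = 0` into the curve
`c̄(x̄+ȳ)² + ȳ(x̄² - k ȳ + x̄ ȳ + h(2x̄+ȳ)) = 0`. -/
theorem stmt13 (g h k c x y : ℂ) (hhk : h + k ≠ 0)
    (E : ℂ) (hE : E = x * y + y ^ 2 - (g + k) * x + (h - k) * y) (hEne : E ≠ 0)
    (xb yb cb : ℂ)
    (hxb : xb = y)
    (hyb : yb = -y * (x * y + y ^ 2 - (g - h) * x + 2 * h * y) / E)
    (hcb : cb = ((g + h) / (h + k)) * (c + g - h))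
    (hcurve : c * (x + y) ^ 2 + y * (x ^ 2 - h * y + x * y + g * (2 * x + y)) = 0) :
    cb * (xb + yb) ^ 2 + yb * (xb ^ 2 - k * yb + xb * yb + h * (2 * xb + yb)) = 0 := by
  have hs : E * (xb + yb) = -((h + k) * y * (x + y)) := by
    rw [hxb, hyb]
    field_simp
    rw [hE]
    ring
  have hy : E * yb = -y * (x * y + y ^ 2 - (g - h) * x + 2 * h * y) := by
    rw [hyb]
    field_simp
  have hc : (h + k) * cb = (g + h) * (c + g - h) := by
    rw [hcb]
    field_simp
  have hsq : cb * (E * (xb + yb)) ^ 2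
      = (g + h) * (h + k) * y ^ 2 * ((c + g - h) * (x + y) ^ 2) := by
    rw [hs]
    linear_combination (h + k) * y ^ 2 * (x + y) ^ 2 * hc
  have hcubic : E * yb * (xb * (E * (xb + yb)) - k * (E * yb)
      + h * (E * xb + E * (xb + yb)))
      = (g + h) * (h + k) * y ^ 2 * (x * (x * y + y ^ 2 - (g - h) * x + 2 * h * y)) := by
    rw [hs, hy, hxb, hE]
    ring
  have key : E ^ 2 * (cb * (xb + yb) ^ 2
      + yb * (xb ^ 2 - k * yb + xb * yb + h * (2 * xb + yb))) = 0 := by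
    linear_combination hsq + hcubic + (g + h) * (h + k) * y ^ 2 * hcurve
  exact (mul_eq_zero.mp key).resolve_left (pow_ne_zero 2 hEne)
end

section
/- Fix a ∈ ℂ with a ≠ 0, and let x, y ∈ ℂ satisfy x + y ≠ 0, y ≠ 0, and D := a·x·y + a·y² + x ≠ 0. Define x̄ = y and ȳ = -y²·(a·x + a·y - 1)/D. Then x̄ + ȳ = y·(x+y)/D ≠ 0 and K(x̄, ȳ) = K(x, y), where K(x,y) := x·y·(a·x + a·y - 1)/(x + y)². That is, K is a conserved quantity of the autonomous mapping. -/
/-- Conserved quantity of the autonomous mapping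
`(x,y) ↦ (y, -y²(ax+ay-1)/(axy+ay²+x))`: with `K(x,y) = xy(ax+ay-1)/(x+y)²`, one has
`x̄ + ȳ = y(x+y)/D ≠ 0` and `K(x̄,ȳ) = K(x,y)`. -/
theorem stmt15 (a x y : ℂ) (ha : a ≠ 0)
    (hxy : x + y ≠ 0) (hy : y ≠ 0)
    (D : ℂ) (hD : D = a * x * y + a * y ^ 2 + x) (hDne : D ≠ 0)
    (xb yb : ℂ)
    (hxb : xb = y)
    (hyb : yb = -y ^ 2 * (a * x + a * y - 1) / D)
    (K : ℂ → ℂ → ℂ)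
    (hK : ∀ u v : ℂ, K u v = u * v * (a * u + a * v - 1) / (u + v) ^ 2) :
    xb + yb = y * (x + y) / D ∧ xb + yb ≠ 0 ∧ K xb yb = K x y := by
  have hsum : xb + yb = y * (x + y) / D := by
    rw [hxb, hyb, eq_div_iff hDne, add_mul, div_mul_cancel₀ _ hDne, hD]
    ring
  have hfactor : a * xb + a * yb - 1 = -x / D := by
    rw [← mul_add, hsum, eq_div_iff hDne, sub_mul, mul_assoc, div_mul_cancel₀ _ hDne, hD]
    ring
  refine ⟨hsum, hsum ▸ div_ne_zero (mul_ne_zero hy hxy) hDne, ?_⟩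
  rw [hK, hK, hfactor, hsum, hxb, hyb]
  field_simp
end
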